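/- Every edge-subgraph independent probability distribution on the simple graphs with vertex set {1,...,n} is matching independent: for every set M of pairwise vertex-disjoint edges, Pr[all edges of M are present] = ∏_{e∈M} Pr[X_e], and more generally the events {X_e : e ∈ M} are mutually independent. -/

import Mathlib

open scoped Classical

noncomputable def pr {n : ℕ} (μ : SimpleGraph (Fin n) → ℝ) (P : SimpleGraph (Fin n) → Prop) : ℝ :=
  ∑ G : SimpleGraph (Fin n), if P G then μ G else 0

def IsDist {n : ℕ} (μ : SimpleGraph (Fin n) → ℝ) : Prop :=
  (∀ G, 0 ≤ μ G) ∧ ∑ G : SimpleGraph (Fin n), μ G = 1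

def EdgeSubgraphIndep {n : ℕ} (μ : SimpleGraph (Fin n) → ℝ) : Prop :=
  ∀ u v : Fin n, u ≠ v → ∀ W : Set (Fin n), u ∉ W → v ∉ W →
    ∀ H : SimpleGraph W,
      pr μ (fun G => G.induce W = H ∧ G.Adj u v)
        = pr μ (fun G => G.induce W = H) * pr μ (fun G => G.Adj u v)

def IsMatchingSet {n : ℕ} (M : Finset (Sym2 (Fin n))) : Prop :=
  (∀ e ∈ M, ¬ e.IsDiag) ∧
    ∀ e ∈ M, ∀ f ∈ M, e ≠ f → ∀ v : Fin n, v ∈ e → v ∉ f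

def MatchingIndep {n : ℕ} (μ : SimpleGraph (Fin n) → ℝ) : Prop :=
  ∀ M : Finset (Sym2 (Fin n)), IsMatchingSet M →
    ∀ S ⊆ M, pr μ (fun G => ∀ e ∈ S, e ∈ G.edgeSet)
      = ∏ e ∈ S, pr μ (fun G => e ∈ G.edgeSet)

theorem pr_fiber {n : ℕ} (μ : SimpleGraph (Fin n) → ℝ) (W : Set (Fin n))
    (Q : SimpleGraph W → Prop) (R : SimpleGraph (Fin n) → Prop) :
    pr μ (fun G => Q (G.induce W) ∧ R G)
      = ∑ H : SimpleGraph W, if Q H then pr μ (fun G => G.induce W = H ∧ R G) else 0 := by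
  have h1 : ∀ H : SimpleGraph W,
      (if Q H then pr μ (fun G => G.induce W = H ∧ R G) else 0)
      = ∑ G : SimpleGraph (Fin n),
        if G.induce W = H then (if Q (G.induce W) ∧ R G then μ G else 0) else 0 := by
    intro H
    by_cases hQ : Q H
    · rw [if_pos hQ]
      unfold pr
      refine Finset.sum_congr rfl fun G _ => ?_
      by_cases hG : G.induce W = H
      · simp [hG, hQ]
      · simp [hG]
    · rw [if_neg hQ]
      symm
      refine Finset.sum_eq_zero fun G _ => ?_
      by_cases hG : G.induce W = H
      · simp [hG, hQ]
      · simp [hG]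
  rw [Finset.sum_congr rfl fun H _ => h1 H, Finset.sum_comm]
  unfold pr
  refine Finset.sum_congr rfl fun G _ => ?_
  simp

theorem pr_event {n : ℕ} (μ : SimpleGraph (Fin n) → ℝ) (h : EdgeSubgraphIndep μ)
    (u v : Fin n) (huv : u ≠ v) (W : Set (Fin n)) (hu : u ∉ W) (hv : v ∉ W)
    (Q : SimpleGraph W → Prop) :
    pr μ (fun G => Q (G.induce W) ∧ G.Adj u v)
      = pr μ (fun G => Q (G.induce W)) * pr μ (fun G => G.Adj u v) := by
  have h2 := pr_fiber μ W Q (fun _ => True)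
  simp only [and_true] at h2
  rw [pr_fiber, h2, Finset.sum_mul]
  refine Finset.sum_congr rfl fun H _ => ?_
  rw [h u v huv W hu hv H]
  split_ifs <;> simp

theorem edge_subgraph_indep_implies_matching_indep (n : ℕ)
    (μ : SimpleGraph (Fin n) → ℝ) (hμ : IsDist μ) (h : EdgeSubgraphIndep μ) :
    MatchingIndep μ := by
  intro M hM S hSM
  have hS : IsMatchingSet S :=
    ⟨fun e he => hM.1 e (hSM he), fun e he f hf => hM.2 e (hSM he) f (hSM hf)⟩
  clear hSM hM M
  induction S using Finset.induction_on with
  | empty => simpa [pr] using hμ.2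
  | insert e S heS ih =>
    have hS' : IsMatchingSet S :=
      ⟨fun e he => hS.1 e (Finset.mem_insert_of_mem he), fun e he f hf =>
        hS.2 e (Finset.mem_insert_of_mem he) f (Finset.mem_insert_of_mem hf)⟩
    rw [Finset.prod_insert heS, ← ih hS']
    have hd := hS.1 e (Finset.mem_insert_self e S)
    have hdis : ∀ f ∈ S, ∀ w, w ∈ e → w ∉ f := fun f hf =>
      hS.2 e (Finset.mem_insert_self e S) f (Finset.mem_insert_of_mem hf)
        (fun hef => heS (hef ▸ hf))
    clear ih hS hS' heS
    induction e using Sym2.ind with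
    | _ u v =>
    have huv : u ≠ v := by simpa using hd
    have key := pr_event μ h u v huv {w | w ≠ u ∧ w ≠ v} (by simp) (by simp)
      (fun H => ∃ G : SimpleGraph (Fin n),
        G.induce {w | w ≠ u ∧ w ≠ v} = H ∧ ∀ e ∈ S, e ∈ G.edgeSet)
    have hQ : ∀ G : SimpleGraph (Fin n),
        (∃ G' : SimpleGraph (Fin n), G'.induce {w | w ≠ u ∧ w ≠ v}
          = G.induce {w | w ≠ u ∧ w ≠ v} ∧ ∀ e ∈ S, e ∈ G'.edgeSet)
        ↔ ∀ e ∈ S, e ∈ G.edgeSet := by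
      intro G
      constructor
      · rintro ⟨G', hG, hE⟩ f hf
        have h1 := hE f hf
        have h2 := hdis f hf
        induction f using Sym2.ind with
        | _ a b =>
        have hua := h2 u (by simp)
        have hva := h2 v (by simp)
        simp only [Sym2.mem_iff, not_or] at hua hva
        have ha : a ∈ {w | w ≠ u ∧ w ≠ v} := ⟨Ne.symm hua.1, Ne.symm hva.1⟩
        have hb : b ∈ {w | w ≠ u ∧ w ≠ v} := ⟨Ne.symm hua.2, Ne.symm hva.2⟩
        have h3 : (G'.induce {w | w ≠ u ∧ w ≠ v}).Adj ⟨a, ha⟩ ⟨b, hb⟩ := h1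
        rw [hG] at h3
        exact h3
      · exact fun hE => ⟨G, rfl, hE⟩
    simp only [hQ] at key
    simp only [Finset.forall_mem_insert, SimpleGraph.mem_edgeSet]
    rw [mul_comm, ← key]
    simp only [and_comm]
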